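/- arXiv:2604.04581 — 3 statements merged into one kernel-verified Lean document; each statement's English description precedes it below -/
import Mathlib

section
/- Let X be a finite nonempty subset of a ring R and K ≥ 1 a natural number. If |X + X| ≤ K·|X| and |X + X·X| ≤ K·|X| (in particular, if |X + X + X·X| ≤ K·|X|), then X − X is a (K⁵ + K¹⁹)-approximate subring of R. -/
open Pointwise

universe u

/-- A subset of a ring is additively symmetric if it contains `0` and equals its negation. -/
def AddSymm {R : Type u} [NonUnitalRing R] (X : Set R) : Prop :=
  (0 : R) ∈ X ∧ X = -X

/-- `X` is a `K`-approximate subring: it is additively symmetric and `X·X ∪ (X+X)` is covered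
by at most `K` additive translates of `X`. -/
def IsApproxSubringWith {R : Type u} [NonUnitalRing R] (K : ℕ) (X : Set R) : Prop :=
  AddSymm X ∧ ∃ F : Finset R, F.card ≤ K ∧ (X * X) ∪ (X + X) ⊆ (F : Set R) + X

/-- `A` and `B` are `N`-commensurable: each is covered by at most `N` additive translates
of the other. -/
def NCommensurable {R : Type u} [NonUnitalRing R] (N : ℕ) (A B : Set R) : Prop :=
  (∃ F : Finset R, F.card ≤ N ∧ A ⊆ (F : Set R) + B) ∧
  (∃ G : Finset R, G.card ≤ N ∧ B ⊆ (G : Set R) + A)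

/-- `mulIter S n` is the set of (left-nested) products of `n+1` elements of `S`. -/
def mulIter {R : Type u} [NonUnitalRing R] (S : Set R) : ℕ → Set R
  | 0 => S
  | n + 1 => mulIter S n * S

/-- `I` is a two-sided ideal of the subring `S` (both given as sets). -/
def IsTwoSidedIdealIn {R : Type u} [NonUnitalRing R] (I S : Set R) : Prop :=
  I ⊆ S ∧ (0 : R) ∈ I ∧ (∀ x ∈ I, ∀ y ∈ I, x + y ∈ I) ∧ (∀ x ∈ I, -x ∈ I) ∧
    ∀ r ∈ S, ∀ x ∈ I, r * x ∈ I ∧ x * r ∈ I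

open Finset in
theorem aux_card {G : Type*} [AddCommGroup G] [DecidableEq G] (X B : Finset G) (hX : X.Nonempty)
    (K : ℕ) (h1 : (X + X).card ≤ K * X.card) (h2 : (X + B).card ≤ K * X.card) :
    ((B + B - (B + B)) + X).card ≤ K ^ 5 * X.card := by
  have hX' : X ∈ X.powerset.erase ∅ :=
    mem_erase_of_ne_of_mem hX.ne_empty (mem_powerset_self _)
  obtain ⟨A, hA, hmin⟩ :=
    exists_min_image (X.powerset.erase ∅) (fun C ↦ (C + B).card / C.card : _ → ℚ≥0) ⟨X, hX'⟩
  rw [mem_erase, mem_powerset, ← nonempty_iff_ne_empty] at hA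
  obtain ⟨hA, hAX⟩ := hA
  have key : ∀ A' ⊆ X, (A + B).card * A'.card ≤ (A' + B).card * A.card := by
    intro A' hA'X
    obtain rfl | hA' := A'.eq_empty_or_nonempty
    · simp
    have hA₀ : (0 : ℚ≥0) < A.card := Nat.cast_pos.2 hA.card_pos
    have hA₀' : (0 : ℚ≥0) < A'.card := Nat.cast_pos.2 hA'.card_pos
    exact mod_cast (div_le_div_iff₀ hA₀ hA₀').1
      (hmin _ <| mem_erase_of_ne_of_mem hA'.ne_empty <| mem_powerset.2 hA'X)
  have hAB : (A + B).card ≤ K * A.card := by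
    refine Nat.le_of_mul_le_mul_right ?_ hX.card_pos
    calc (A + B).card * X.card ≤ (X + B).card * A.card := key X subset_rfl
      _ ≤ K * X.card * A.card := by gcongr
      _ = K * A.card * X.card := by ring
  have pet : ∀ C : Finset G, (C + A + B).card ≤ K * (C + A).card := by
    intro C
    refine Nat.le_of_mul_le_mul_right ?_ hA.card_pos
    calc (C + A + B).card * A.card ≤ (A + B).card * (C + A).card :=
          pluennecke_petridis_inequality_add C fun A' h ↦ key A' (h.trans hAX)
      _ ≤ K * A.card * (C + A).card := by gcongr
      _ = K * (C + A).card * A.card := by ring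
  have e1 : (B + B + A).card ≤ K ^ 2 * A.card := by
    calc (B + B + A).card = (B + A + B).card := by rw [add_right_comm]
      _ ≤ K * (B + A).card := pet B
      _ = K * (A + B).card := by rw [add_comm]
      _ ≤ K * (K * A.card) := by gcongr
      _ = _ := by ring
  have e2 : (X + (B + B) + A).card ≤ K ^ 3 * X.card := by
    calc (X + (B + B) + A).card = (X + B + A + B).card := by
          rw [add_right_comm (X + B), add_assoc X B B]
      _ ≤ K * (X + B + A).card := pet _
      _ = K * (X + A + B).card := by rw [add_right_comm]
      _ ≤ K * (K * (X + A).card) := by gcongr; exact pet _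
      _ ≤ K * (K * (X + X).card) := by gcongr
      _ ≤ K * (K * (K * X.card)) := by gcongr
      _ = _ := by ring
  refine Nat.le_of_mul_le_mul_right ?_ hA.card_pos
  have e3 : B + B - (B + B) + X = X + (B + B) - (B + B) := by
    rw [add_comm, ← add_sub_assoc X]
  rw [e3]
  calc (X + (B + B) - (B + B)).card * A.card
      ≤ (X + (B + B) + A).card * (B + B + A).card := ruzsa_triangle_inequality_sub_add_add _ _ _
    _ ≤ (K ^ 3 * X.card) * (K ^ 2 * A.card) := by gcongr
    _ = _ := by ring

open Finset in
theorem aux_cover {G : Type*} [AddCommGroup G] [DecidableEq G] (X B : Finset G) (hX : X.Nonempty)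
    (K : ℕ) (h1 : (X + X).card ≤ K * X.card) (h2 : (X + B).card ≤ K * X.card) :
    ∃ F : Finset G, F.card ≤ K ^ 5 ∧ B + B - (B + B) ⊆ F + (X - X) := by
  obtain ⟨F, -, hF, hc⟩ := ruzsa_covering_add (K := (K ^ 5 : ℕ)) (A := B + B - (B + B)) hX
    (by exact_mod_cast aux_card X B hX K h1 h2)
  exact ⟨F, by exact_mod_cast hF, hc⟩

/-- Plünnecke–Ruzsa-type remark: if `X` is a finite nonempty subset of a ring with
`|X + X| ≤ K|X|` and `|X + X·X| ≤ K|X|`, then `X - X` is a `(K⁵ + K¹⁹)`-approximate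
subring. -/
theorem stmt15 {R : Type u} [NonUnitalRing R] (X : Set R) (hfin : X.Finite)
    (hne : X.Nonempty) (K : ℕ) (hK : 1 ≤ K)
    (h1 : (X + X).ncard ≤ K * X.ncard)
    (h2 : (X + X * X).ncard ≤ K * X.ncard) :
    IsApproxSubringWith (K ^ 5 + K ^ 19) (X - X) := by
  classical
  lift X to Finset R using hfin
  have hX : X.Nonempty := by simpa using hne
  rw [← Finset.coe_add, Set.ncard_coe_finset, Set.ncard_coe_finset] at h1
  rw [← Finset.coe_mul, ← Finset.coe_add, Set.ncard_coe_finset, Set.ncard_coe_finset] at h2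
  obtain ⟨F, hF, hFc⟩ := aux_cover X X hX K h1 h1
  obtain ⟨F', hF', hFc'⟩ := aux_cover X (X * X) hX K h1 h2
  refine ⟨⟨?_, ?_⟩, F ∪ F', ?_, ?_⟩
  · obtain ⟨x, hx⟩ := hne
    exact Set.mem_sub.2 ⟨x, hx, x, hx, sub_self x⟩
  · rw [neg_sub]
  · refine (Finset.card_union_le _ _).trans (add_le_add hF (hF'.trans ?_))
    exact Nat.pow_le_pow_right hK (by norm_num)
  · rw [Finset.coe_union, Set.union_add]
    apply Set.union_subset
    · refine Set.Subset.trans ?_ Set.subset_union_right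
      rw [← Finset.coe_sub, ← Finset.coe_add]
      refine Set.Subset.trans ?_ (Finset.coe_subset.2 hFc')
      rintro _ ⟨u, hu, v, hv, rfl⟩
      obtain ⟨a, ha, b, hb, rfl⟩ := Finset.mem_sub.1 (Finset.mem_coe.1 hu)
      obtain ⟨c, hc, d, hd, rfl⟩ := Finset.mem_sub.1 (Finset.mem_coe.1 hv)
      refine Finset.mem_coe.2 (Finset.mem_sub.2 ⟨a * c + b * d,
        Finset.add_mem_add (Finset.mul_mem_mul ha hc) (Finset.mul_mem_mul hb hd),
        a * d + b * c,
        Finset.add_mem_add (Finset.mul_mem_mul ha hd) (Finset.mul_mem_mul hb hc), ?_⟩)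
      simp only [sub_mul, mul_sub]
      abel
    · refine Set.Subset.trans ?_ Set.subset_union_left
      rw [← Finset.coe_sub, ← Finset.coe_add, ← Finset.coe_add]
      refine Finset.coe_subset.2 (Finset.Subset.trans ?_ hFc)
      rw [sub_add_sub_comm]
end

section
/- Let K ∈ ℕ, let R be a ring, let X ⊆ R be a K-approximate subring, and let H ⊆ R be a subring. Then Y := (4X + X·4X) ∩ H is a (K^510 + K^22)-approximate subring of R. -/
open Pointwise

universe u

/-- `S` is a subring of the ambient ring (as a set). -/
def IsSubringSet {R : Type u} [NonUnitalRing R] (S : Set R) : Prop :=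
  (0 : R) ∈ S ∧ (∀ x ∈ S, ∀ y ∈ S, x + y ∈ S) ∧ (∀ x ∈ S, -x ∈ S) ∧
    ∀ x ∈ S, ∀ y ∈ S, x * y ∈ S

/-- `A` is covered by at most `K ^ n` translates of the `m`-fold sumset of `X`. -/
def SumCov {R : Type u} [NonUnitalRing R] (K : ℕ) (X : Set R) (n m : ℕ) (A : Set R) : Prop :=
  ∃ F : Finset R, F.card ≤ K ^ n ∧ A ⊆ (F : Set R) + m • X

theorem SumCov.mono {R : Type u} [NonUnitalRing R] {K : ℕ} {X : Set R} {n m : ℕ} {A B : Set R}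
    (h : SumCov K X n m B) (hAB : A ⊆ B) : SumCov K X n m A := by
  obtain ⟨F, hF, h⟩ := h
  exact ⟨F, hF, hAB.trans h⟩

theorem SumCov.add {R : Type u} [NonUnitalRing R] {K : ℕ} {X : Set R} {n m n' m' : ℕ}
    {A B : Set R} (hA : SumCov K X n m A) (hB : SumCov K X n' m' B) :
    SumCov K X (n + n') (m + m') (A + B) := by
  classical
  obtain ⟨F, hF, hA⟩ := hA
  obtain ⟨G, hG, hB⟩ := hB
  refine ⟨F + G, ?_, ?_⟩
  · rw [pow_add]
    exact Finset.card_add_le.trans (Nat.mul_le_mul hF hG)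
  · rw [Finset.coe_add, add_nsmul, add_add_add_comm]
    exact Set.add_subset_add hA hB

theorem SumCov.smul {R : Type u} [NonUnitalRing R] {K : ℕ} {X : Set R} {n m : ℕ}
    {A : Set R} (hA : SumCov K X n m A) (j : ℕ) : SumCov K X (j * n) (j * m) (j • A) := by
  induction j with
  | zero => exact ⟨{0}, by simp, by simp⟩
  | succ j ih =>
    rw [Nat.succ_mul, Nat.succ_mul, succ_nsmul]
    exact ih.add hA

theorem SumCov.self {R : Type u} [NonUnitalRing R] {K : ℕ} {X : Set R} (j : ℕ) :
    SumCov K X 0 j (j • X) := ⟨{0}, by simp, by simp⟩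

theorem SumCov.red {R : Type u} [NonUnitalRing R] {K : ℕ} {X : Set R} (hX : SumCov K X 1 1 (X + X))
    {n m : ℕ} {A : Set R} (hA : SumCov K X n (m + 2) A) : SumCov K X (n + 1) (m + 1) A := by
  classical
  have h2 : SumCov K X 1 (m + 1) ((m + 2) • X) := by
    have := (SumCov.self (K := K) (X := X) m).add hX
    rwa [zero_add, ← two_nsmul, ← add_nsmul] at this
  obtain ⟨F, hF, hA⟩ := hA
  obtain ⟨G, hG, hB⟩ := h2
  refine ⟨F + G, ?_, ?_⟩
  · rw [pow_add]
    exact Finset.card_add_le.trans (Nat.mul_le_mul hF hG)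
  · rw [Finset.coe_add, add_assoc]
    exact hA.trans (Set.add_subset_add_left hB)

theorem SumCov.redN {R : Type u} [NonUnitalRing R] {K : ℕ} {X : Set R} (hX : SumCov K X 1 1 (X + X))
    {n m : ℕ} {A : Set R} (j : ℕ) (hA : SumCov K X n (m + j + 1) A) :
    SumCov K X (n + j) (m + 1) A := by
  induction j generalizing n with
  | zero => exact hA
  | succ j ih =>
    have := ih (SumCov.red hX (m := m + j) hA)
    rwa [add_right_comm] at this

theorem mul_data {R : Type u} [NonUnitalRing R] (X : Set R) (hs : ∀ x ∈ X, -x ∈ X) (F : Set R)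
    (hF : X * X ⊆ F + X) :
    ∃ a b c : R → R, ∀ x ∈ X, ∀ y ∈ X, ∃ f ∈ F, ∃ w ∈ X, x * y = f + w ∧
      a f ∈ X ∧ b f ∈ X ∧ c f ∈ X ∧ f = a f * b f + c f := by
  have : ∀ f : R, ∃ a b c : R, (∃ x ∈ X, ∃ y ∈ X, ∃ w ∈ X, x * y = f + w) →
      a ∈ X ∧ b ∈ X ∧ c ∈ X ∧ f = a * b + c := by
    intro f
    by_cases h : ∃ x ∈ X, ∃ y ∈ X, ∃ w ∈ X, x * y = f + w
    · obtain ⟨x, hx, y, hy, w, hw, e⟩ := h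
      exact ⟨x, y, -w, fun _ => ⟨hx, hy, hs w hw, by rw [e]; abel⟩⟩
    · exact ⟨0, 0, 0, fun h' => absurd h' h⟩
  choose a b c h using this
  refine ⟨a, b, c, fun x hx y hy => ?_⟩
  obtain ⟨f, hf, w, hw, e⟩ := Set.mem_add.1 (hF (Set.mul_mem_mul hx hy))
  exact ⟨f, hf, w, hw, e.symm, h f ⟨x, hx, y, hy, w, hw, e.symm⟩⟩

theorem cov3 {R : Type u} [NonUnitalRing R] {K : ℕ} (X : Set R) (hs : ∀ x ∈ X, -x ∈ X)
    (F : Finset R) (hK : F.card ≤ K) (hF : X * X ⊆ (F : Set R) + X) :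
    SumCov K X 5 3 (X * X * X) := by
  classical
  obtain ⟨a, b, c, h⟩ := mul_data X hs F hF
  have hT : SumCov K X 2 0 (((F ×ˢ F).image fun p => a p.1 * p.2 : Finset R) : Set R) := by
    refine ⟨_, Finset.card_image_le.trans ?_, by rw [zero_nsmul, add_zero]⟩
    rw [Finset.card_product, pow_two]
    exact Nat.mul_le_mul hK hK
  have h1 : SumCov K X 1 1 (X * X) := ⟨F, by simpa using hK, by simpa using hF⟩
  refine (hT.add (h1.smul 3)).mono ?_
  rintro _ ⟨_, ⟨x, hx, y, hy, rfl⟩, z, hz, rfl⟩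
  obtain ⟨f, hf, w, hw, e, ha, hb, hc, hfe⟩ := h x hx y hy
  obtain ⟨g, hg, v, hv, e2, -⟩ := h _ hb z hz
  refine ⟨a f * g, ?_, a f * v + c f * z + w * z, ?_, ?_⟩
  · simp only [Finset.coe_image, Set.mem_image]
    exact ⟨(f, g), by simpa using ⟨hf, hg⟩, rfl⟩
  · rw [show (3 : ℕ) = 2 + 1 from rfl, succ_nsmul, two_nsmul]
    exact Set.add_mem_add (Set.add_mem_add (Set.mul_mem_mul ha hv) (Set.mul_mem_mul hc hz))
      (Set.mul_mem_mul hw hz)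
  · have e3 : f * z = a f * (b f * z) + c f * z := by
      conv_lhs => rw [hfe]
      rw [add_mul, mul_assoc]
    show a f * g + (a f * v + c f * z + w * z) = x * y * z
    rw [e, add_mul, e3, e2, mul_add]
    abel

theorem cov4 {R : Type u} [NonUnitalRing R] {K : ℕ} (X : Set R) (hs : ∀ x ∈ X, -x ∈ X)
    (F : Finset R) (hK : F.card ≤ K) (hF : X * X ⊆ (F : Set R) + X) :
    SumCov K X 9 5 ((X * X) * (X * X)) := by
  classical
  obtain ⟨a, b, c, h⟩ := mul_data X hs F hF
  have hT : SumCov K X 4 0 ((((F ×ˢ F) ×ˢ (F ×ˢ F)).image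
      fun p => p.1.1 * p.1.2 + a p.1.1 * p.2.1 + p.2.2 * b p.1.2 : Finset R) : Set R) := by
    refine ⟨_, Finset.card_image_le.trans ?_, by rw [zero_nsmul, add_zero]⟩
    rw [Finset.card_product, Finset.card_product, show 4 = 2 + 2 from rfl, pow_add, pow_two]
    exact Nat.mul_le_mul (Nat.mul_le_mul hK hK) (Nat.mul_le_mul hK hK)
  have h1 : SumCov K X 1 1 (X * X) := ⟨F, by simpa using hK, by simpa using hF⟩
  refine (hT.add (h1.smul 5)).mono ?_
  rintro _ ⟨_, ⟨x, hx, y, hy, rfl⟩, _, ⟨z, hz, w, hw, rfl⟩, rfl⟩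
  obtain ⟨f, hf, u, hu, e, haf, hbf, hcf, hfe⟩ := h x hx y hy
  obtain ⟨g, hg, v, hv, e2, hag, hbg, hcg, hge⟩ := h z hz w hw
  obtain ⟨p, hp, v', hv', e3, -⟩ := h _ hbf v hv
  obtain ⟨k, hk, u', hu', e4, -⟩ := h u hu _ hag
  refine ⟨f * g + a f * p + k * b g, ?_,
    a f * v' + c f * v + u' * b g + u * c g + u * v, ?_, ?_⟩
  · simp only [Finset.coe_image, Set.mem_image]
    exact ⟨((f, g), (p, k)), by
      simpa using ⟨⟨hf, hg⟩, ⟨hp, hk⟩⟩, rfl⟩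
  · rw [show (5 : ℕ) = 2 + 1 + 1 + 1 from rfl, succ_nsmul, succ_nsmul, succ_nsmul, two_nsmul]
    exact Set.add_mem_add (Set.add_mem_add (Set.add_mem_add (Set.add_mem_add
      (Set.mul_mem_mul haf hv') (Set.mul_mem_mul hcf hv)) (Set.mul_mem_mul hu' hbg))
      (Set.mul_mem_mul hu hcg)) (Set.mul_mem_mul hu hv)
  · have e5 : f * v = a f * (b f * v) + c f * v := by
      conv_lhs => rw [hfe]
      rw [add_mul, mul_assoc]
    have e6 : u * g = (u * a g) * b g + u * c g := by
      conv_lhs => rw [hge]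
      rw [mul_add, mul_assoc]
    show f * g + a f * p + k * b g + (a f * v' + c f * v + u' * b g + u * c g + u * v)
      = x * y * (z * w)
    rw [e, e2, add_mul, mul_add, mul_add, e5, e6, e3, e4, mul_add, add_mul]
    abel

theorem four_mul_sub {R : Type u} [NonUnitalRing R] (A B : Set R) :
    (4 • A) * (4 • B) ⊆ 16 • (A * B) := by
  have h1 : ∀ C : Set R, (4 • A) * C ⊆ 4 • (A * C) := by
    intro C
    rintro _ ⟨_, ha, z, hz, rfl⟩
    rw [show (4 : ℕ) = 2 + 1 + 1 from rfl, succ_nsmul, succ_nsmul, two_nsmul] at ha ⊢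
    obtain ⟨_, ⟨_, ⟨a, ha, b, hb, rfl⟩, c, hc, rfl⟩, d, hd, rfl⟩ := ha
    simp only [add_mul]
    exact Set.add_mem_add (Set.add_mem_add (Set.add_mem_add (Set.mul_mem_mul ha hz)
      (Set.mul_mem_mul hb hz)) (Set.mul_mem_mul hc hz)) (Set.mul_mem_mul hd hz)
  have h2 : A * (4 • B) ⊆ 4 • (A * B) := by
    rintro _ ⟨z, hz, _, ha, rfl⟩
    rw [show (4 : ℕ) = 2 + 1 + 1 from rfl, succ_nsmul, succ_nsmul, two_nsmul] at ha ⊢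
    obtain ⟨_, ⟨_, ⟨a, ha, b, hb, rfl⟩, c, hc, rfl⟩, d, hd, rfl⟩ := ha
    simp only [mul_add]
    exact Set.add_mem_add (Set.add_mem_add (Set.add_mem_add (Set.mul_mem_mul hz ha)
      (Set.mul_mem_mul hz hb)) (Set.mul_mem_mul hz hc)) (Set.mul_mem_mul hz hd)
  refine (h1 _).trans ?_
  rw [show 16 = 4 * 4 from rfl, mul_nsmul]
  exact Set.nsmul_subset_nsmul_left h2

theorem mul_four_sub {R : Type u} [NonUnitalRing R] (A B : Set R) :
    A * (4 • B) ⊆ 4 • (A * B) := by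
  rintro _ ⟨z, hz, _, ha, rfl⟩
  rw [show (4 : ℕ) = 2 + 1 + 1 from rfl, succ_nsmul, succ_nsmul, two_nsmul] at ha ⊢
  obtain ⟨_, ⟨_, ⟨a, ha, b, hb, rfl⟩, c, hc, rfl⟩, d, hd, rfl⟩ := ha
  simp only [mul_add]
  exact Set.add_mem_add (Set.add_mem_add (Set.add_mem_add (Set.mul_mem_mul hz ha)
    (Set.mul_mem_mul hz hb)) (Set.mul_mem_mul hz hc)) (Set.mul_mem_mul hz hd)

/-- Covering an intersection with a subgroup. -/
theorem cov_inter {R : Type u} [NonUnitalRing R] {K n : ℕ} {X : Set R} (hs : ∀ x ∈ X, -x ∈ X)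
    {A Z H : Set R} (hA : SumCov K X n 2 A) (hZ : 4 • X ⊆ Z)
    (hadd : ∀ x ∈ H, ∀ y ∈ H, x + y ∈ H) (hneg : ∀ x ∈ H, -x ∈ H) :
    ∃ F : Finset R, F.card ≤ K ^ n ∧ A ∩ H ⊆ (F : Set R) + (Z ∩ H) := by
  classical
  obtain ⟨F, hF, hA⟩ := hA
  have : ∀ f : R, ∃ r : R, (∃ t ∈ H, ∃ s ∈ 2 • X, t = f + s) →
      r ∈ H ∧ ∃ s ∈ 2 • X, r = f + s := by
    intro f
    by_cases h : ∃ t ∈ H, ∃ s ∈ 2 • X, t = f + s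
    · obtain ⟨t, ht, h⟩ := h
      exact ⟨t, fun _ => ⟨ht, h⟩⟩
    · exact ⟨0, fun h' => absurd h' h⟩
  choose r hr using this
  refine ⟨F.image r, Finset.card_image_le.trans hF, ?_⟩
  rintro t ⟨htA, htH⟩
  obtain ⟨f, hf, s, hs', e⟩ := Set.mem_add.1 (hA htA)
  obtain ⟨hrH, s', hs'', e'⟩ := hr f ⟨t, htH, s, hs', e.symm⟩
  refine ⟨r f, by simpa using ⟨f, hf, rfl⟩, t - r f, ⟨hZ ?_, ?_⟩, by simp⟩
  · have : t - r f = s + -s' := by rw [← e, e']; abel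
    rw [this, show 4 = 2 + 2 from rfl, add_nsmul]
    refine Set.add_mem_add hs' ?_
    rw [two_nsmul] at hs'' ⊢
    obtain ⟨p, hp, q, hq, rfl⟩ := hs''
    exact ⟨-p, hs p hp, -q, hs q hq, by simp only; abel⟩
  · rw [sub_eq_add_neg]
    exact hadd _ htH _ (hneg _ hrH)

/-- If `X` is a `K`-approximate subring and `H` a subring of the ambient ring, then
`(4X + X·4X) ∩ H` is a `(K^510 + K^22)`-approximate subring. -/
theorem stmt16 {R : Type u} [NonUnitalRing R] (K : ℕ) (X : Set R)
    (hX : IsApproxSubringWith K X) (H : Set R) (hH : IsSubringSet H)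
    (Y : Set R) (hY : Y = ((X + X + X + X) + X * (X + X + X + X)) ∩ H) :
    IsApproxSubringWith (K ^ 510 + K ^ 22) Y := by
  classical
  obtain ⟨⟨h0, hsym⟩, F, hFK, hF⟩ := hX
  obtain ⟨H0, Hadd, Hneg, Hmul⟩ := hH
  have hs : ∀ x ∈ X, -x ∈ X := by
    intro x hx
    rw [hsym] at hx
    exact hx
  have h4 : X + X + X + X = 4 • X := by
    rw [show (4 : ℕ) = 2 + 1 + 1 from rfl, succ_nsmul, succ_nsmul, two_nsmul]
  rw [h4] at hY
  have hs4 : ∀ x ∈ 4 • X, -x ∈ 4 • X := by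
    rw [← h4]
    rintro _ ⟨_, ⟨_, ⟨a, ha, b, hb, rfl⟩, c, hc, rfl⟩, d, hd, rfl⟩
    simp only [neg_add]
    exact Set.add_mem_add (Set.add_mem_add (Set.add_mem_add (hs _ ha) (hs _ hb)) (hs _ hc))
      (hs _ hd)
  have h04 : (0 : R) ∈ 4 • X := by
    rw [← h4]
    exact ⟨0, ⟨0, ⟨0, h0, 0, h0, by simp⟩, 0, h0, by simp⟩, 0, h0, by simp⟩
  have hFm : X * X ⊆ (F : Set R) + X := Set.subset_union_left.trans hF
  have hFa : SumCov K X 1 1 (X + X) :=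
    ⟨F, by simpa using hFK, by simpa using Set.subset_union_right.trans hF⟩
  have c2 : SumCov K X 1 1 (X * X) := ⟨F, by simpa using hFK, by simpa using hFm⟩
  have c3 := cov3 X hs F hFK hFm
  have c4 := cov4 X hs F hFK hFm
  set Z : Set R := 4 • X + X * (4 • X) with hZdef
  have hZ4 : 4 • X ⊆ Z := fun x hx => ⟨x, hx, 0, ⟨0, h0, 0, h04, by simp⟩, by simp⟩
  have hZs : ∀ x ∈ Z, -x ∈ Z := by
    rintro _ ⟨p, hp, _, ⟨q, hq, t, ht, rfl⟩, rfl⟩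
    exact ⟨-p, hs4 p hp, _, ⟨-q, hs q hq, t, ht, rfl⟩, by simp only; rw [neg_mul, neg_add]⟩
  have hZ' : Z ⊆ 4 • X + 4 • (X * X) := Set.add_subset_add_left (mul_four_sub X X)
  have cZ : SumCov K X 4 8 Z := ((SumCov.self 4).add (c2.smul 4)).mono hZ'
  have cZZ : SumCov K X 22 2 (Z + Z) := SumCov.redN hFa (m := 1) 14 (cZ.add cZ)
  have cM : SumCov K X 510 2 (Z * Z) := by
    have := ((c2.smul 16).add ((c3.smul 16).add ((c3.smul 16).add (c4.smul 16))))
    refine SumCov.redN hFa (m := 1) (n := 320) 190 (this.mono ?_)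
    refine (Set.mul_subset_mul hZ' hZ').trans ?_
    rintro _ ⟨_, ⟨p, hp, q, hq, rfl⟩, _, ⟨r, hr, s, hs, rfl⟩, rfl⟩
    refine ⟨p * r, four_mul_sub _ _ (Set.mul_mem_mul hp hr), _,
      ⟨p * s, ?_, _, ⟨q * r, four_mul_sub _ _ (Set.mul_mem_mul hq hr), q * s,
        four_mul_sub _ _ (Set.mul_mem_mul hq hs), rfl⟩, rfl⟩, ?_⟩
    · rw [mul_assoc]
      exact four_mul_sub _ _ (Set.mul_mem_mul hp hs)
    · simp only [add_mul, mul_add]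
      abel
  obtain ⟨F1, hF1, hc1⟩ := cov_inter hs cM hZ4 Hadd Hneg
  obtain ⟨F2, hF2, hc2⟩ := cov_inter hs cZZ hZ4 Hadd Hneg
  subst hY
  refine ⟨⟨⟨hZ4 h04, H0⟩, ?_⟩, F1 ∪ F2,
    (Finset.card_union_le _ _).trans (Nat.add_le_add hF1 hF2), ?_⟩
  · ext x
    constructor
    · rintro ⟨h1, h2⟩
      exact ⟨hZs x h1, Hneg x h2⟩
    · rintro ⟨h1, h2⟩
      have a1 := hZs _ h1
      have a2 := Hneg _ h2
      rw [neg_neg] at a1 a2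
      exact ⟨a1, a2⟩
  · rw [Finset.coe_union, Set.union_add]
    refine Set.union_subset_union (Set.Subset.trans ?_ hc1) (Set.Subset.trans ?_ hc2)
    · rintro _ ⟨x, ⟨hx, hx'⟩, y, ⟨hy, hy'⟩, rfl⟩
      exact ⟨Set.mul_mem_mul hx hy, Hmul _ hx' _ hy'⟩
    · rintro _ ⟨x, ⟨hx, hx'⟩, y, ⟨hy, hy'⟩, rfl⟩
      exact ⟨Set.add_mem_add hx hy, Hadd _ hx' _ hy'⟩
end

section
/- Let R be a ring (associative, possibly non-unital or noncommutative) and let I₁ ⊆ I₂ be two-sided ideals of R such that I₁ is finite, I₂/I₁ is null in R/I₁ (that is, R·I₂ ⊆ I₁ and I₂·R ⊆ I₁), and the additive group of I₂/I₁ is cyclic, generated by u + I₁ for some u ∈ I₂ (that is, I₂ = ℤ·u + I₁). Then there exists n ∈ ℕ such that the additive subgroup J := ℤ·(n·u) generated by n·u has finite index in the additive group of I₂ and J is null in R, i.e. R·J = J·R = {0}; in particular, J is a two-sided ideal of R. -/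
open Pointwise

universe u

/-- If `I₁ ⊆ I₂` are two-sided ideals of a ring `R` with `I₁` finite, `I₂/I₁` null in `R/I₁`
(i.e. `R·I₂ ⊆ I₁` and `I₂·R ⊆ I₁`), and the additive group of `I₂/I₁` cyclic generated by
`u + I₁` (i.e. `I₂ = ℤ·u + I₁`), then for some `n ∈ ℕ` the additive subgroup
`J = ℤ·(n·u)` has finite index in the additive group of `I₂` and is null in `R`
(`R·J = J·R = {0}`); in particular `J` is a two-sided ideal of `R`. -/
theorem stmt19 {R : Type u} [NonUnitalRing R] (I₁ I₂ : Set R) (h12 : I₁ ⊆ I₂)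
    (hI₁ : IsTwoSidedIdealIn I₁ Set.univ) (hI₂ : IsTwoSidedIdealIn I₂ Set.univ)
    (hfin : I₁.Finite)
    (hnull : ∀ r : R, ∀ x ∈ I₂, r * x ∈ I₁ ∧ x * r ∈ I₁)
    (u : R) (hu : u ∈ I₂)
    (hcyc : I₂ = {x : R | ∃ k : ℤ, x = k • u} + I₁) :
    ∃ n : ℕ,
      (∃ F : Set R, F.Finite ∧ I₂ ⊆ F + {x : R | ∃ k : ℤ, x = k • (n • u)}) ∧
      ∀ r : R, ∀ x ∈ {x : R | ∃ k : ℤ, x = k • (n • u)}, r * x = 0 ∧ x * r = 0 := by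
  obtain ⟨-, h0, hadd, hneg, -⟩ := hI₁
  let A : AddSubgroup R :=
    { carrier := I₁
      zero_mem' := h0
      add_mem' := fun {x y} hx hy => hadd x hx y hy
      neg_mem' := fun {x} hx => hneg x hx }
  haveI : Finite A := hfin.to_subtype
  have hkill : ∀ y ∈ I₁, Nat.card A • y = 0 := by
    intro y hy
    have h : Nat.card A • (⟨y, hy⟩ : A) = 0 := card_nsmul_eq_zero'
    exact congrArg Subtype.val h
  have hpos : 0 < Nat.card A := Nat.card_pos
  generalize Nat.card A = n at hkill hpos
  refine ⟨n, ⟨(fun k : ℤ => k • u) '' (Set.Ico 0 (n : ℤ)) + I₁,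
    ((Set.finite_Ico _ _).image _).add hfin, ?_⟩, ?_⟩
  · intro x hx
    rw [hcyc] at hx
    obtain ⟨a, ⟨k, rfl⟩, i, hi, rfl⟩ := hx
    have hn : (n : ℤ) ≠ 0 := by omega
    refine ⟨(k % n) • u + i, ⟨_, ⟨k % n, ⟨Int.emod_nonneg _ hn,
      Int.emod_lt_of_pos _ (by omega)⟩, rfl⟩, i, hi, rfl⟩, _, ⟨k / n, rfl⟩, ?_⟩
    have e : k • u = (k % n) • u + (k / n) • (n • u) := by
      rw [← natCast_zsmul u n, ← mul_zsmul', ← add_zsmul]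
      congr 1
      exact (Int.emod_add_mul_ediv k n).symm
    change (k % n) • u + i + (k / n) • (n • u) = k • u + i
    rw [e]
    abel
  · rintro r x ⟨k, rfl⟩
    obtain ⟨h1, h2⟩ := hnull r u hu
    constructor
    · rw [mul_smul_comm, mul_smul_comm, hkill _ h1, smul_zero]
    · rw [smul_mul_assoc, smul_mul_assoc, hkill _ h2, smul_zero]
end
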